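/- arXiv:2605.01731 — 4 statements merged into one kernel-verified Lean document; each statement's English description precedes it below -/
import Mathlib

section
/- For each ω ∈ ℝ let A(ω) be an invertible 2×2 complex matrix, let b(ω) ∈ ℂ² be a column vector and k(ω) ∈ ℂ² a row vector, and define H(ω) = I₂ + A(ω)⁻¹ · (b(ω) kᵀ(ω)), where b(ω) kᵀ(ω) denotes the 2×2 outer-product matrix (vecMulVec). Then the ℓ²→ℓ² operator norm of H(ω) is at least 1 for every ω ∈ ℝ; consequently there is no constant γ ∈ [0,1) with ‖H(ω)‖ ≤ γ for all ω ∈ ℝ. -/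
/-- Perturbing the identity by a singular matrix cannot bring the `ℓ²` operator norm below `1`. -/
theorem one_le_norm_toEuclideanCLM_one_add {𝕜 n : Type*} [RCLike 𝕜] [Fintype n] [DecidableEq n]
    {N : Matrix n n 𝕜} (hN : N.det = 0) :
    1 ≤ ‖(Matrix.toEuclideanCLM (𝕜 := 𝕜) (n := n) (1 + N) :
      EuclideanSpace 𝕜 n →L[𝕜] EuclideanSpace 𝕜 n)‖ := by
  obtain ⟨v, hv, hNv⟩ := Matrix.exists_mulVec_eq_zero_iff.mpr hN
  have hfix : Matrix.toEuclideanCLM (𝕜 := 𝕜) (n := n) (1 + N) (WithLp.toLp 2 v) =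
      WithLp.toLp 2 v := by
    rw [Matrix.toEuclideanCLM_toLp, Matrix.add_mulVec, Matrix.one_mulVec, hNv, add_zero]
  have hpos : 0 < ‖(WithLp.toLp 2 v : EuclideanSpace 𝕜 n)‖ := by
    simpa using hv
  have hle := (Matrix.toEuclideanCLM (𝕜 := 𝕜) (n := n) (1 + N)).le_opNorm (WithLp.toLp 2 v)
  rw [hfix] at hle
  exact (le_mul_iff_one_le_left hpos).mp hle

/-- Common core of Propositions 1 and 3: if for each frequency `ω` the
inter-vehicle transfer matrix is `H(ω) = I₂ + A(ω)⁻¹ · (b(ω) kᵀ(ω))` with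
`A(ω)` invertible and `b(ω) kᵀ(ω)` an outer product of a column vector and a
row vector, then the `ℓ² → ℓ²` operator norm of `H(ω)` is at least `1` at
every `ω`; consequently there is no `γ ∈ [0,1)` bounding all these norms. -/
theorem opNorm_identity_plus_rank_one_ge_one
    (A : ℝ → Matrix (Fin 2) (Fin 2) ℂ) (hA : ∀ ω : ℝ, IsUnit (A ω))
    (b k : ℝ → Fin 2 → ℂ)
    (H : ℝ → Matrix (Fin 2) (Fin 2) ℂ)
    (hH : ∀ ω : ℝ, H ω = 1 + (A ω)⁻¹ * Matrix.vecMulVec (b ω) (k ω)) :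
    (∀ ω : ℝ, 1 ≤ ‖(Matrix.toEuclideanCLM (𝕜 := ℂ) (n := Fin 2) (H ω) :
        EuclideanSpace ℂ (Fin 2) →L[ℂ] EuclideanSpace ℂ (Fin 2))‖) ∧
    ¬ ∃ γ : ℝ, 0 ≤ γ ∧ γ < 1 ∧
        ∀ ω : ℝ, ‖(Matrix.toEuclideanCLM (𝕜 := ℂ) (n := Fin 2) (H ω) :
          EuclideanSpace ℂ (Fin 2) →L[ℂ] EuclideanSpace ℂ (Fin 2))‖ ≤ γ := by
  have hnorm : ∀ ω : ℝ, 1 ≤ ‖(Matrix.toEuclideanCLM (𝕜 := ℂ) (n := Fin 2) (H ω) :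
      EuclideanSpace ℂ (Fin 2) →L[ℂ] EuclideanSpace ℂ (Fin 2))‖ := by
    intro ω
    rw [hH ω]
    exact one_le_norm_toEuclideanCLM_one_add (by
      rw [Matrix.det_mul, Matrix.det_vecMulVec, mul_zero])
  refine ⟨hnorm, ?_⟩
  rintro ⟨γ, -, hγ, hbound⟩
  exact absurd ((hnorm 0).trans (hbound 0)) hγ.not_ge
end

section
/- Let C_f, C_r, a, b, k_elat, k_θ be real numbers with C_f > 0, C_r > 0, a > 0, b > 0, and k_elat ≠ 0. Define the 2×2 real matrix A = !![C_f·k_elat, C_f·k_θ − (C_f + C_r); a·C_f·k_elat, a·C_f·k_θ − (a·C_f − b·C_r)] and the outer-product matrix W = !![C_f·k_elat, C_f·k_θ; a·C_f·k_elat, a·C_f·k_θ] (i.e., W = B·K_P with B = (C_f, a·C_f)ᵀ and K_P = (k_elat, k_θ)). Then A⁻¹ · W = !![1, k_θ/k_elat; 0, 0]. In particular, the (1,2) entry of A⁻¹·W equals k_θ/k_elat, which is nonzero whenever k_θ ≠ 0. -/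
/-- Key computation in the proof of Proposition 2: with `A = L + B·K_P` the DC
closed-loop matrix and `W = B·K_P` the outer product of the steering input
vector and the proportional gain row vector, `A⁻¹ · W = !![1, kθ/kelat; 0, 0]`;
in particular the `(1,2)` entry equals `kθ/kelat`, nonzero whenever `kθ ≠ 0`. -/
theorem dc_inverse_mul_outer_product
    (Cf Cr a b kelat kθ : ℝ)
    (hCf : 0 < Cf) (hCr : 0 < Cr) (ha : 0 < a) (hb : 0 < b)
    (hke : kelat ≠ 0)
    (A W : Matrix (Fin 2) (Fin 2) ℝ)
    (hA : A = !![Cf * kelat, Cf * kθ - (Cf + Cr);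
                 a * Cf * kelat, a * Cf * kθ - (a * Cf - b * Cr)])
    (hW : W = !![Cf * kelat, Cf * kθ;
                 a * Cf * kelat, a * Cf * kθ]) :
    A⁻¹ * W = !![1, kθ / kelat; 0, 0] ∧
    ((A⁻¹ * W) 0 1 = kθ / kelat ∧ (kθ ≠ 0 → (A⁻¹ * W) 0 1 ≠ 0)) := by
  have hdet : A.det = Cf * kelat * Cr * (a + b) := by
    rw [hA, Matrix.det_fin_two_of]
    ring
  have hunit : IsUnit A.det := by
    rw [hdet, isUnit_iff_ne_zero]
    have hab : a + b ≠ 0 := by positivity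
    exact mul_ne_zero (mul_ne_zero (mul_ne_zero hCf.ne' hke) hCr.ne') hab
  have hfactor : W = A * !![1, kθ / kelat; 0, 0] := by
    rw [hA, hW, Matrix.mul_fin_two]
    ext i j
    fin_cases i <;> fin_cases j <;> simp <;> field_simp
  have hmain : A⁻¹ * W = !![1, kθ / kelat; 0, 0] := by
    rw [hfactor, Matrix.nonsing_inv_mul_cancel_left A _ hunit]
  have hentry : (A⁻¹ * W) 0 1 = kθ / kelat := by
    simp [hmain]
  exact ⟨hmain, hentry, fun hθ => hentry ▸ div_ne_zero hθ hke⟩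
end

section
/- Let C_f, C_r, a, b, k_elat, k_θ be real numbers with C_f > 0, C_r > 0, a > 0, b > 0, and k_elat ≠ 0. Define the 2×2 real matrix A = !![C_f·k_elat, C_f·k_θ − (C_f + C_r); a·C_f·k_elat, a·C_f·k_θ − (a·C_f − b·C_r)] and the vector B = (C_f, a·C_f)ᵀ. Then the first entry of A⁻¹·B (matrix–vector product) equals 1/k_elat; consequently 1 + K_LP·((A⁻¹·B)₁) = (k_elat + K_LP)/k_elat for any real K_LP, and if moreover k_elat > 0, then |(k_elat + K_LP)/k_elat| < 1 if and only if −2·k_elat < K_LP < 0. -/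
open Matrix

/-- DC value computation for the learn-from-predecessor strategy: the first
entry of `A⁻¹ ⬝ B` equals `1/kelat`; consequently the DC transfer value is
`H(0) = 1 + K_LP · (A⁻¹ ⬝ B)₁ = (kelat + K_LP)/kelat`, and when `kelat > 0`,
`|H(0)| < 1` iff `-2·kelat < K_LP < 0`. -/
theorem dc_value_learn_from_predecessor
    (Cf Cr a b kelat kθ : ℝ)
    (hCf : 0 < Cf) (hCr : 0 < Cr) (ha : 0 < a) (hb : 0 < b)
    (hke : kelat ≠ 0)
    (A : Matrix (Fin 2) (Fin 2) ℝ)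
    (hA : A = !![Cf * kelat, Cf * kθ - (Cf + Cr);
                 a * Cf * kelat, a * Cf * kθ - (a * Cf - b * Cr)])
    (B : Fin 2 → ℝ) (hB : B = ![Cf, a * Cf]) :
    (A⁻¹ *ᵥ B) 0 = 1 / kelat ∧
    (∀ KLP : ℝ, 1 + KLP * (A⁻¹ *ᵥ B) 0 = (kelat + KLP) / kelat) ∧
    (kelat > 0 → ∀ KLP : ℝ,
      (|(kelat + KLP) / kelat| < 1 ↔ -2 * kelat < KLP ∧ KLP < 0)) := by
  have hdet : IsUnit A.det := by
    have h : A.det = Cf * kelat * (Cr * (a + b)) := by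
      rw [hA, det_fin_two_of]
      ring
    rw [h, isUnit_iff_ne_zero]
    positivity
  have hAB : B = A *ᵥ ![1 / kelat, 0] := by
    subst hA hB
    ext i
    fin_cases i <;> simp [mulVec, dotProduct, Fin.sum_univ_two, hke]
  have h0 : (A⁻¹ *ᵥ B) 0 = 1 / kelat := by
    rw [hAB, mulVec_mulVec, nonsing_inv_mul A hdet, one_mulVec]
    rfl
  refine ⟨h0, fun KLP => ?_, fun hk KLP => ?_⟩
  · rw [h0]
    field_simp
  · rw [abs_lt, lt_div_iff₀ hk, div_lt_iff₀ hk]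
    constructor <;> rintro ⟨h₁, h₂⟩ <;> constructor <;> linarith
end

section
/- Let C_f, C_r, a, b, m, I_z, v_x, k_elat, k_θ, k_ė, k_θ̇ be real numbers. For s ∈ ℂ define the 2×2 complex matrix M(s) with entries M(s)₁₁ = m·v_x²·s² + (C_f·k_ė·v_x + C_f + C_r)·s + C_f·k_elat, M(s)₁₂ = (a·C_f − b·C_r + C_f·k_θ̇·v_x)·s + C_f·(k_θ − 1) − C_r, M(s)₂₁ = (a·C_f − b·C_r + a·C_f·k_ė·v_x)·s + a·C_f·k_elat, M(s)₂₂ = I_z·v_x²·s² + (a²·C_f + b²·C_r + a·C_f·k_θ̇·v_x)·s + a·C_f·(k_θ − 1) + b·C_r, and let B = (C_f, a·C_f)ᵀ. Then for every s ∈ ℂ, the first entry of (adjugate M(s))·B equals C_f·(I_z·v_x²·s² + b·(a+b)·C_r·s + (a+b)·C_r). -/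
open Matrix

/-- Identity used in the proof of Proposition 4: the first entry of
`(adjugate M(s)) ⬝ B`, for the Laplace-domain closed-loop matrix `M(s)` of
the lateral tracking error dynamics and steering input vector
`B = (C_f, a·C_f)ᵀ`, equals `C_f·(I_z·v_x²·s² + b·(a+b)·C_r·s + (a+b)·C_r)`,
independently of the feedback gains. -/
theorem adjugate_mulVec_first_entry
    (Cf Cr a b m Iz vx kelat kθ kde kdθ : ℝ)
    (M : ℂ → Matrix (Fin 2) (Fin 2) ℂ)
    (hM : ∀ s : ℂ, M s =
      !![(m * vx ^ 2 : ℝ) * s ^ 2 + (Cf * kde * vx + Cf + Cr : ℝ) * s +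
           (Cf * kelat : ℝ),
         (a * Cf - b * Cr + Cf * kdθ * vx : ℝ) * s + (Cf * (kθ - 1) - Cr : ℝ);
         (a * Cf - b * Cr + a * Cf * kde * vx : ℝ) * s + (a * Cf * kelat : ℝ),
         (Iz * vx ^ 2 : ℝ) * s ^ 2 + (a ^ 2 * Cf + b ^ 2 * Cr + a * Cf * kdθ * vx : ℝ) * s +
           (a * Cf * (kθ - 1) + b * Cr : ℝ)]) :
    ∀ s : ℂ,
      ((M s).adjugate *ᵥ ![(Cf : ℂ), (a * Cf : ℝ)]) 0 =
        (Cf : ℂ) * ((Iz * vx ^ 2 : ℝ) * s ^ 2 + (b * (a + b) * Cr : ℝ) * s +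
          ((a + b) * Cr : ℝ)) := by
  intro s
  rw [hM s, adjugate_fin_two_of]
  simp only [mulVec, dotProduct, Fin.sum_univ_two, of_apply, cons_val_zero, cons_val_one]
  push_cast
  ring
end
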